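/- arXiv:1907.09990 — 2 statements merged into one kernel-verified Lean document; each statement's English description precedes it below -/
import Mathlib

section
/- For a spectrally negative Lévy process with Laplace exponent ψ and scale functions W_p, W_s (defined by ∫_0^∞ e^{-λy} W_q(y) dy = 1/(ψ(λ)-q) for λ > Φ_q), for all s, p ≥ 0 and x ≥ 0 one has (s - p) ∫_0^x W_p(x-y) W_s(y) dy = W_s(x) - W_p(x). -/
open MeasureTheory Real

open Filter Topology Set in
lemma lap_integrable_mono {V : ℝ → ℝ} (hV : Continuous V) {L l : ℝ} (hLl : L ≤ l)
    (hI : IntegrableOn (fun y => Real.exp (-L * y) * V y) (Ioi 0)) :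
    IntegrableOn (fun y => Real.exp (-l * y) * V y) (Ioi 0) := by
  refine Integrable.mono hI (by fun_prop) ?_
  filter_upwards [ae_restrict_mem measurableSet_Ioi] with y hy
  have hy' : (0:ℝ) < y := hy
  rw [norm_mul, norm_mul]
  gcongr
  simp only [Real.norm_eq_abs, Real.abs_exp]
  apply Real.exp_le_exp.mpr
  nlinarith

open Filter Topology Set in
lemma lap_tendsto_zero {V : ℝ → ℝ} (hV : Continuous V) {L : ℝ}
    (hI : IntegrableOn (fun y => Real.exp (-L * y) * V y) (Ioi 0)) :
    Tendsto (fun l => ∫ y in Ioi (0:ℝ), Real.exp (-l * y) * V y) atTop (𝓝 0) := by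
  have h0 : (0:ℝ) = ∫ y in Ioi (0:ℝ), (0:ℝ) := by simp
  suffices hmain : Tendsto (fun l => ∫ y in Ioi (0:ℝ), Real.exp (-l * y) * V y) atTop
      (𝓝 (∫ y in Ioi (0:ℝ), (0:ℝ))) by
    rwa [← h0] at hmain
  refine tendsto_integral_filter_of_dominated_convergence (l := atTop) (f := fun _ => (0:ℝ))
    (F := fun l y => Real.exp (-l * y) * V y)
    (fun y => ‖Real.exp (-L * y) * V y‖) ?_ ?_ hI.norm ?_
  · exact Eventually.of_forall fun l => by fun_prop
  · filter_upwards [eventually_ge_atTop L] with l hl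
    filter_upwards [ae_restrict_mem measurableSet_Ioi] with y hy
    have hy' : (0:ℝ) < y := hy
    rw [norm_mul, norm_mul]
    gcongr
    simp only [Real.norm_eq_abs, Real.abs_exp]
    apply Real.exp_le_exp.mpr
    nlinarith
  · filter_upwards [ae_restrict_mem measurableSet_Ioi] with y hy
    have hy' : (0:ℝ) < y := hy
    have h1 : Tendsto (fun l : ℝ => Real.exp (-l * y)) atTop (𝓝 0) := by
      refine Real.tendsto_exp_atBot.comp ?_
      exact tendsto_neg_atTop_atBot.atBot_mul_const hy'
    simpa using h1.mul_const (V y)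

open Filter Topology Set in
lemma lap_unique {f : ℝ → ℝ} (hf : Continuous f) {L : ℝ}
    (hI : IntegrableOn (fun y => Real.exp (-L * y) * f y) (Ioi 0))
    (h0 : ∀ l ≥ L, ∫ y in Ioi (0:ℝ), Real.exp (-l * y) * f y = 0) :
    ∀ x ≥ 0, f x = 0 := by
  set h : ℝ → ℝ := fun y => Real.exp (-L * y) * f y with hh
  have hc : Continuous h := by fun_prop
  have hn : ∀ n : ℕ, ∀ y, Real.exp (-y) ^ n * h y = Real.exp (-(L + n) * y) * f y := by
    intro n y
    rw [hh, ← Real.exp_nat_mul]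
    simp only
    rw [← mul_assoc, ← Real.exp_add]
    ring_nf
  have hnI : ∀ n : ℕ, IntegrableOn (fun y => Real.exp (-y) ^ n * h y) (Ioi 0) := by
    intro n
    simp_rw [hn]
    exact lap_integrable_mono hf (by simp) hI
  have hPe : ∀ (P : Polynomial ℝ) (y : ℝ), P.eval (Real.exp (-y)) * h y =
      ∑ i ∈ Finset.range (P.natDegree + 1), P.coeff i * (Real.exp (-y) ^ i * h y) := by
    intro P y
    rw [Polynomial.eval_eq_sum_range, Finset.sum_mul]
    exact Finset.sum_congr rfl fun i _ => by ring
  have hPI : ∀ P : Polynomial ℝ, IntegrableOn (fun y => P.eval (Real.exp (-y)) * h y) (Ioi 0) := by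
    intro P
    simp_rw [hPe]
    exact integrable_finsetSum _ fun i _ => (hnI i).const_mul _
  have hP0 : ∀ P : Polynomial ℝ, ∫ y in Ioi (0:ℝ), P.eval (Real.exp (-y)) * h y = 0 := by
    intro P
    simp_rw [hPe]
    rw [integral_finsetSum _ fun i _ => (hnI i).const_mul _]
    refine Finset.sum_eq_zero fun i _ => ?_
    rw [integral_const_mul]
    simp_rw [hn]
    rw [h0 _ (by simp), mul_zero]
  have key : ∀ᵐ x, x ∈ Ioi (0:ℝ) → h x = 0 := by
    refine isOpen_Ioi.ae_eq_zero_of_integral_contDiff_smul_eq_zero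
      (hc.locallyIntegrable.locallyIntegrableOn _) ?_
    intro φ hφ hφc hφs
    have hφ0 : ∀ y ≤ 0, φ y = 0 := by
      intro y hy
      by_contra hne
      exact absurd (hφs (subset_tsupport φ hne)) (by simpa using hy)
    obtain ⟨M, hM⟩ : ∃ M : ℝ, ∀ y > M, φ y = 0 := by
      obtain ⟨M, hM⟩ := hφc.isCompact.bddAbove
      refine ⟨M, fun y hy => ?_⟩
      by_contra hne
      exact absurd (hM (subset_tsupport φ hne)) (not_le.mpr hy)
    have hgc : ContinuousOn (fun t => φ (-Real.log t)) (Icc 0 1) := by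
      intro t ht
      apply ContinuousAt.continuousWithinAt
      rcases eq_or_ne t 0 with rfl | hne
      · have : (fun t => φ (-Real.log t)) =ᶠ[𝓝 0] fun _ => 0 := by
          filter_upwards [Metric.ball_mem_nhds (0:ℝ) (Real.exp_pos (-M))] with u hu
          rcases eq_or_ne u 0 with rfl | hu0
          · simp [hφ0]
          · apply hM
            have hu' : |u| < Real.exp (-M) := by simpa using hu
            have := Real.log_lt_log (abs_pos.mpr hu0) hu'
            rw [Real.log_abs, Real.log_exp] at this
            linarith
        exact continuousAt_const.congr this.symm
      · exact hφ.continuous.continuousAt.comp (Real.continuousAt_log hne).neg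
    have hφI : IntegrableOn (fun y => φ y * h y) (Ioi 0) :=
      ((hφ.continuous.mul hc).integrable_of_hasCompactSupport hφc.mul_right).integrableOn
    have e1 : ∫ x, φ x • h x = ∫ y in Ioi (0:ℝ), φ y * h y := by
      symm
      refine setIntegral_eq_integral_of_forall_compl_eq_zero fun y hy => ?_
      rw [hφ0 y (by simpa using hy), zero_mul]
    rw [e1]
    have bound : ∀ ε > 0, |∫ y in Ioi (0:ℝ), φ y * h y| ≤ ε * ∫ y in Ioi (0:ℝ), |h y| := by
      intro ε hε
      obtain ⟨P, hP⟩ := exists_polynomial_near_of_continuousOn 0 1 _ hgc ε hε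
      have e2 : ∫ y in Ioi (0:ℝ), φ y * h y =
          ∫ y in Ioi (0:ℝ), (φ y * h y - P.eval (Real.exp (-y)) * h y) := by
        rw [integral_sub hφI (hPI P), hP0, sub_zero]
      rw [e2, ← integral_const_mul, ← Real.norm_eq_abs]
      refine norm_integral_le_of_norm_le (hI.norm.const_mul ε) ?_
      filter_upwards [ae_restrict_mem measurableSet_Ioi] with y hy
      have hy' : (0:ℝ) < y := hy
      have := hP (Real.exp (-y)) ⟨(Real.exp_pos _).le, by simpa using hy'.le⟩
      simp only [Real.log_exp, neg_neg] at this
      rw [← sub_mul, norm_mul, Real.norm_eq_abs, abs_sub_comm, Real.norm_eq_abs]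
      exact mul_le_mul_of_nonneg_right this.le (abs_nonneg _)
    have hlim : Tendsto (fun ε : ℝ => ε * ∫ y in Ioi (0:ℝ), |h y|) (𝓝[>] 0) (𝓝 0) := by
      have : Tendsto (fun ε : ℝ => ε * ∫ y in Ioi (0:ℝ), |h y|) (𝓝 0) (𝓝 (0 * _)) :=
        tendsto_id.mul_const _
      rw [zero_mul] at this
      exact this.mono_left nhdsWithin_le_nhds
    have := ge_of_tendsto hlim (eventually_mem_nhdsWithin.mono fun ε hε => bound ε hε)
    exact abs_nonpos_iff.mp this
  have hEq : EqOn h (fun _ => 0) (Ioi 0) := by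
    refine Measure.eqOn_open_of_ae_eq (μ := volume) ?_ isOpen_Ioi hc.continuousOn
      continuousOn_const
    exact (ae_restrict_iff' measurableSet_Ioi).mpr key
  have hEq2 : EqOn h (fun _ => 0) (Ici 0) := by
    have := hEq.closure hc continuous_const
    rwa [closure_Ioi] at this
  intro x hx
  have := hEq2 hx
  simpa [hh, Real.exp_ne_zero] using this

/-- Convolution identity for scale functions of a spectrally negative Lévy process:
`(s - p) ∫_0^x W_p(x-y) W_s(y) dy = W_s(x) - W_p(x)`. -/
theorem scale_convolution_identity
    (ψ : ℝ → ℝ) (Φ : ℝ → ℝ) (W : ℝ → ℝ → ℝ)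
    (hW_cont : ∀ q ≥ (0:ℝ), ContinuousOn (W q) (Set.Ici 0))
    (hW_mono : ∀ q ≥ (0:ℝ), MonotoneOn (W q) (Set.Ici 0))
    (hW_zero : ∀ q ≥ (0:ℝ), ∀ x < (0:ℝ), W q x = 0)
    (hW_lap : ∀ q ≥ (0:ℝ), ∀ l, l > Φ q →
      ∫ y in Set.Ioi (0:ℝ), Real.exp (-l * y) * W q y = 1 / (ψ l - q)) :
    ∀ s ≥ (0:ℝ), ∀ p ≥ (0:ℝ), ∀ x ≥ (0:ℝ),
      (s - p) * ∫ y in (0:ℝ)..x, W p (x - y) * W s y = W s x - W p x := by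
  classical
  set V : ℝ → ℝ → ℝ := fun q x => W q (max x 0) with hVdef
  have hVW : ∀ q, ∀ x ≥ (0:ℝ), V q x = W q x := fun q x hx => by simp [hVdef, max_eq_left hx]
  have hVc : ∀ q ≥ (0:ℝ), Continuous (V q) := fun q hq =>
    (hW_cont q hq).comp_continuous (by fun_prop) fun x => le_max_right x 0
  have hlap : ∀ q ≥ (0:ℝ), ∀ l > Φ q,
      ∫ y in Set.Ioi (0:ℝ), Real.exp (-l * y) * V q y = 1 / (ψ l - q) := by
    intro q hq l hl
    rw [← hW_lap q hq l hl]
    refine setIntegral_congr_fun measurableSet_Ioi fun y hy => ?_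
    rw [hVW q y (le_of_lt hy)]
  have hint : ∀ q ≥ (0:ℝ), ∃ L, IntegrableOn (fun y => Real.exp (-L * y) * V q y) (Set.Ioi 0) := by
    intro q hq
    by_contra! hcon
    have hψ : ∀ l > Φ q, ψ l = q := by
      intro l hl
      have h1 := hlap q hq l hl
      rw [integral_undef (hcon l)] at h1
      have : ψ l - q = 0 := by simpa using h1.symm
      linarith
    have hq1 : q + 1 ≥ 0 := by linarith
    have hF : ∀ l > max (Φ q) (Φ (q+1)),
        ∫ y in Set.Ioi (0:ℝ), Real.exp (-l * y) * V (q+1) y = -1 := by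
      intro l hl
      rw [hlap (q+1) hq1 l ((le_max_right _ _).trans_lt hl), hψ l ((le_max_left _ _).trans_lt hl)]
      norm_num
    have hI1 : IntegrableOn
        (fun y => Real.exp (-(max (Φ q) (Φ (q+1)) + 1) * y) * V (q+1) y) (Set.Ioi 0) := by
      by_contra hn
      have := hF _ (lt_add_one _)
      rw [integral_undef hn] at this
      norm_num at this
    have ht := lap_tendsto_zero (hVc _ hq1) hI1
    have ht2 : Filter.Tendsto (fun l => ∫ y in Set.Ioi (0:ℝ), Real.exp (-l * y) * V (q+1) y)
        Filter.atTop (nhds (-1)) := by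
      refine tendsto_const_nhds.congr' ?_
      filter_upwards [Filter.eventually_gt_atTop (max (Φ q) (Φ (q+1)))] with l hl
      exact (hF l hl).symm
    have := tendsto_nhds_unique ht ht2
    norm_num at this
  intro s hs p hp
  rcases eq_or_ne s p with rfl | hsp
  · intro x _; simp
  have hd : 0 < |1 / (s - p)| := abs_pos.mpr (one_div_ne_zero (sub_ne_zero.mpr hsp))
  obtain ⟨Ls, hLs⟩ := hint s hs
  obtain ⟨Lp, hLp⟩ := hint p hp
  have evs := (lap_tendsto_zero (hVc s hs) hLs).eventually (Metric.ball_mem_nhds 0 hd)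
  have evp := (lap_tendsto_zero (hVc p hp) hLp).eventually (Metric.ball_mem_nhds 0 hd)
  obtain ⟨L, hL⟩ := Filter.eventually_atTop.mp
    (evs.and (evp.and ((Filter.eventually_gt_atTop (Φ s)).and ((Filter.eventually_gt_atTop (Φ p)).and
    ((Filter.eventually_ge_atTop Ls).and (Filter.eventually_ge_atTop Lp))))))
  have hIs : ∀ l ≥ L, IntegrableOn (fun y => Real.exp (-l * y) * V s y) (Set.Ioi 0) :=
    fun l hl => lap_integrable_mono (hVc s hs) (hL l hl).2.2.2.2.1 hLs
  have hIp : ∀ l ≥ L, IntegrableOn (fun y => Real.exp (-l * y) * V p y) (Set.Ioi 0) :=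
    fun l hl => lap_integrable_mono (hVc p hp) (hL l hl).2.2.2.2.2 hLp
  have hid : ∀ l ≥ L, (s - p) * ((∫ y in Set.Ioi (0:ℝ), Real.exp (-l * y) * V s y) *
      (∫ y in Set.Ioi (0:ℝ), Real.exp (-l * y) * V p y)) =
      (∫ y in Set.Ioi (0:ℝ), Real.exp (-l * y) * V s y) -
      ∫ y in Set.Ioi (0:ℝ), Real.exp (-l * y) * V p y := by
    intro l hl
    obtain ⟨h1, h2, h3, h4, -, -⟩ := hL l hl
    rw [hlap s hs l h3] at h1 ⊢
    rw [hlap p hp l h4] at h2 ⊢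
    simp only [Metric.mem_ball, dist_zero_right, Real.norm_eq_abs] at h1 h2
    have hn1 : ψ l - s ≠ 0 := by
      intro h
      have : ψ l - p = s - p := by linarith
      rw [this] at h2
      exact lt_irrefl _ h2
    have hn2 : ψ l - p ≠ 0 := by
      intro h
      have : ψ l - s = -(s - p) := by linarith
      rw [this, div_neg, abs_neg] at h1
      exact lt_irrefl _ h1
    field_simp
    ring
  set C : ℝ → ℝ := fun x => ∫ y in (0:ℝ)..x, V p (x - y) * V s y with hC
  have hCc : Continuous C := by
    have h1 := hVc p hp
    have h2 := hVc s hs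
    refine intervalIntegral.continuous_parametric_intervalIntegral_of_continuous
      (f := fun x y => V p (x - y) * V s y) ?_ continuous_id
    unfold Function.uncurry
    fun_prop
  have hker : ∀ l x, (∫ t in (0:ℝ)..x, ContinuousLinearMap.mul ℝ ℝ (Real.exp (-l * t) * V s t)
      (Real.exp (-l * (x - t)) * V p (x - t))) = Real.exp (-l * x) * C x := by
    intro l x
    rw [hC]
    simp only
    rw [← intervalIntegral.integral_const_mul]
    refine intervalIntegral.integral_congr fun t _ => ?_
    simp only [ContinuousLinearMap.mul_apply']
    have : Real.exp (-l * x) = Real.exp (-l * t) * Real.exp (-l * (x - t)) := by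
      rw [← Real.exp_add]; ring_nf
    rw [this]; ring
  have hCL : ∀ l ≥ L, ∫ x in Set.Ioi (0:ℝ), Real.exp (-l * x) * C x =
      (∫ y in Set.Ioi (0:ℝ), Real.exp (-l * y) * V s y) *
      (∫ y in Set.Ioi (0:ℝ), Real.exp (-l * y) * V p y) := by
    intro l hl
    have := integral_posConvolution (hIs l hl) (hIp l hl) (ContinuousLinearMap.mul ℝ ℝ)
    simp_rw [hker] at this
    simpa using this
  have hCI : ∀ l ≥ L, IntegrableOn (fun x => Real.exp (-l * x) * C x) (Set.Ioi 0) := by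
    intro l hl
    have := integrable_posConvolution (hIs l hl) (hIp l hl) (ContinuousLinearMap.mul ℝ ℝ)
    unfold posConvolution at this
    simp_rw [hker] at this
    exact (integrable_indicator_iff measurableSet_Ioi).mp this
  have hexp : ∀ l x, Real.exp (-l * x) * ((s - p) * C x - (V s x - V p x)) =
      (s - p) * (Real.exp (-l * x) * C x) -
        (Real.exp (-l * x) * V s x - Real.exp (-l * x) * V p x) := by
    intro l x; ring
  have hfin : ∀ x ≥ 0, (s - p) * C x - (V s x - V p x) = 0 := by
    have h1 := hVc p hp
    have h2 := hVc s hs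
    refine lap_unique (f := fun x => (s - p) * C x - (V s x - V p x)) (L := L) (by fun_prop) ?_ ?_
    · simp_rw [hexp]
      exact ((hCI L le_rfl).const_mul _).sub ((hIs L le_rfl).sub (hIp L le_rfl))
    · intro l hl
      simp_rw [hexp]
      have hsub : IntegrableOn (fun x => Real.exp (-l * x) * V s x - Real.exp (-l * x) * V p x)
        (Set.Ioi 0) := (hIs l hl).sub (hIp l hl)
      rw [integral_sub ((hCI l hl).const_mul _) hsub,
        integral_sub (hIs l hl) (hIp l hl), integral_const_mul, hCL l hl, hid l hl, sub_self]
  intro x hx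
  have h := hfin x hx
  rw [hVW s x hx, hVW p x hx] at h
  have hCx : C x = ∫ y in (0:ℝ)..x, W p (x - y) * W s y := by
    refine intervalIntegral.integral_congr fun y hy => ?_
    rw [Set.uIcc_of_le hx] at hy
    rw [hVW p _ (sub_nonneg.mpr hy.2), hVW s _ hy.1]
  rw [← hCx]
  linarith
end

section
/- For θ large enough and x ≥ 0, Z_q(x,θ)/(ψ_{q+λ}(θ)ψ_{q+p}(θ)) = ∫_{-∞}^0 e^{θy} (𝒲_x^{(q,λ)}(x−y) − 𝒲_x^{(q,p)}(x−y))/(λ − p) dy, where λ ≠ p. -/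
open MeasureTheory Real

/-- Second-generation scale function `𝒲_a^{(p,s)}(x)`. -/
noncomputable def secondScale (W : ℝ → ℝ → ℝ) (a p s x : ℝ) : ℝ :=
  W p x + s * ∫ y in a..x, W (p + s) (x - y) * W p y

/-- Two-parameter scale function `Z_q(a,θ)`. -/
noncomputable def Zscale (ψ : ℝ → ℝ) (W : ℝ → ℝ → ℝ) (q a θ : ℝ) : ℝ :=
  Real.exp (θ * a) * (1 - (ψ θ - q) * ∫ y in (0:ℝ)..a, Real.exp (-θ * y) * W q y)


open Set Filter Topology

lemma aux_exp_up (f : ℝ → ℝ) (l l' : ℝ) (h : l ≤ l')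
    (hf : IntegrableOn (fun y => Real.exp (-l * y) * f y) (Ioi 0)) :
    IntegrableOn (fun y => Real.exp (-l' * y) * f y) (Ioi 0) := by
  have h1 : IntegrableOn (fun y => Real.exp (-(l' - l) * y) * (Real.exp (-l * y) * f y))
      (Ioi 0) := by
    refine Integrable.mono hf (AEStronglyMeasurable.mul (by fun_prop) hf.1) ?_
    refine (ae_restrict_iff' measurableSet_Ioi).2 (Eventually.of_forall fun y hy => ?_)
    rw [norm_mul]
    refine mul_le_of_le_one_left (norm_nonneg _) ?_
    rw [Real.norm_eq_abs, abs_of_pos (Real.exp_pos _), Real.exp_le_one_iff]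
    have : 0 < y := hy
    nlinarith
  refine h1.congr_fun (fun y _ => ?_) measurableSet_Ioi
  simp only
  rw [← mul_assoc, ← Real.exp_add]
  congr 2
  ring

lemma aux_tendsto (f : ℝ → ℝ) (l : ℝ)
    (hf : IntegrableOn (fun y => Real.exp (-l * y) * f y) (Ioi 0)) :
    Tendsto (fun n : ℕ => ∫ y in Ioi (0:ℝ), Real.exp (-(l + n) * y) * f y) atTop (𝓝 0) := by
  suffices h0 : Tendsto (fun n : ℕ => ∫ y in Ioi (0:ℝ), Real.exp (-(l + n) * y) * f y) atTop
      (𝓝 (∫ y in Ioi (0:ℝ), (0:ℝ))) by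
    rwa [integral_zero] at h0
  refine tendsto_integral_of_dominated_convergence
    (fun y => ‖Real.exp (-l * y) * f y‖) (fun n => ?_) hf.norm (fun n => ?_) ?_
  · exact (aux_exp_up f l (l + n) (by simp) hf).1
  · refine (ae_restrict_iff' measurableSet_Ioi).2 (Eventually.of_forall fun y hy => ?_)
    rw [norm_mul, norm_mul]
    refine mul_le_mul_of_nonneg_right ?_ (norm_nonneg _)
    rw [Real.norm_eq_abs, Real.norm_eq_abs, abs_of_pos (Real.exp_pos _),
      abs_of_pos (Real.exp_pos _), Real.exp_le_exp]
    have : 0 < y := hy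
    have hn : (0:ℝ) ≤ n := Nat.cast_nonneg n
    nlinarith
  · refine (ae_restrict_iff' measurableSet_Ioi).2 (Eventually.of_forall fun y hy => ?_)
    have hy : 0 < y := hy
    have h1 : Tendsto (fun n : ℕ => Real.exp (-(l + n) * y)) atTop (𝓝 0) := by
      refine Real.tendsto_exp_atBot.comp ?_
      have h2 : Tendsto (fun n : ℕ => l + (n:ℝ)) atTop atTop :=
        tendsto_atTop_add_const_left _ _ tendsto_natCast_atTop_atTop
      exact (tendsto_neg_atTop_atBot.comp h2).atBot_mul_const hy
    simpa using h1.mul_const (f y)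

lemma aux_exists (ψ Φ : ℝ → ℝ) (W : ℝ → ℝ → ℝ)
    (hW_lap : ∀ s ≥ (0:ℝ), ∀ l, l > Φ s →
      ∫ y in Set.Ioi (0:ℝ), Real.exp (-l * y) * W s y = 1 / (ψ l - s))
    (q : ℝ) (hq : 0 ≤ q) :
    ∃ l, IntegrableOn (fun y => Real.exp (-l * y) * W q y) (Ioi 0) := by
  by_contra hcon
  push Not at hcon
  have hψ : ∀ l, l > Φ q → ψ l = q := by
    intro l hl
    by_contra hne
    refine hcon l ?_
    by_contra hni
    have h := hW_lap q hq l hl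
    rw [integral_undef hni] at h
    exact one_div_ne_zero (sub_ne_zero.2 hne) h.symm
  set l := max (Φ q) (Φ (q + 1)) + 1 with hldef
  have hint : ∀ l' ≥ l, ∫ y in Ioi (0:ℝ), Real.exp (-l' * y) * W (q + 1) y = -1 := by
    intro l' hl'
    have h1 := le_max_left (Φ q) (Φ (q + 1))
    have h2 := le_max_right (Φ q) (Φ (q + 1))
    rw [hW_lap (q + 1) (by linarith) l' (by linarith), hψ l' (by linarith)]
    norm_num
  have hI : IntegrableOn (fun y => Real.exp (-l * y) * W (q + 1) y) (Ioi 0) := by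
    by_contra hni
    have h := hint l le_rfl
    rw [integral_undef hni] at h
    norm_num at h
  have ht := aux_tendsto _ l hI
  have : (fun n : ℕ => ∫ y in Ioi (0:ℝ), Real.exp (-(l + n) * y) * W (q + 1) y)
      = fun _ => (-1 : ℝ) := by
    funext n
    exact hint _ (by simp)
  rw [this] at ht
  have := tendsto_nhds_unique ht tendsto_const_nhds
  norm_num at this

lemma aux_shift (f : ℝ → ℝ) (x : ℝ) (hx : 0 ≤ x) (hf : IntegrableOn f (Ioi 0)) :
    IntegrableOn (fun z => f (x + z)) (Ioi 0) := by
  have h1 : IntegrableOn f (Ioi x) := hf.mono_set (Ioi_subset_Ioi hx)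
  have h2 := (measurePreserving_add_left (volume : Measure ℝ) x).integrableOn_comp_preimage
    (measurableEmbedding_addLeft x) (f := f) (s := Ioi x)
  have h3 : (fun z => x + z) ⁻¹' Ioi x = Ioi 0 := by
    ext z; simp
  rw [h3] at h2
  exact h2.2 h1

lemma aux_F (Wq Wt : ℝ → ℝ) (l θ c x : ℝ) (hx : 0 ≤ x)
    (hq : IntegrableOn (fun y => Real.exp (-l * y) * Wq y) (Ioi 0))
    (ht : IntegrableOn (fun y => Real.exp (-θ * y) * Wt y) (Ioi 0))
    (hU : IntegrableOn (fun z => Real.exp (-θ * z) *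
      (Wq z + c * ∫ y in (0:ℝ)..z, Wt (z - y) * Wq y)) (Ioi 0)) :
    IntegrableOn (fun z => Real.exp (-θ * z) *
      (Wq (x + z) + c * ∫ y in x..(x + z), Wt (x + z - y) * Wq y)) (Ioi 0) := by
  -- local integrability of the convolution integrand
  set m := max l θ with hm
  have hqm := aux_exp_up Wq l m (le_max_left _ _) hq
  have htm := aux_exp_up Wt θ m (le_max_right _ _) ht
  have hex : ∀ᵐ u : ℝ, 0 < u → IntegrableOn (fun y => Wt (u - y) * Wq y) (Ioo 0 u) := by
    have := Integrable.ae_convolution_exists (ContinuousLinearMap.mul ℝ ℝ)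
      ((integrable_indicator_iff measurableSet_Ioi).2 hqm)
      ((integrable_indicator_iff measurableSet_Ioi).2 htm)
    filter_upwards [this] with u hu hu0
    have h1 : IntegrableOn _ (Ioo 0 u) := (hu.integrableOn.const_mul (Real.exp (m * u)))
    refine h1.congr_fun (fun y hy => ?_) measurableSet_Ioo
    have e1 : y ∈ Ioi (0:ℝ) := hy.1
    have e2 : u - y ∈ Ioi (0:ℝ) := sub_pos.2 hy.2
    simp only [indicator_of_mem e1, indicator_of_mem e2, ContinuousLinearMap.mul_apply']
    have e3 : Real.exp (m * u) * (Real.exp (-m * y) * Real.exp (-m * (u - y))) = 1 := by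
      rw [← Real.exp_add, ← Real.exp_add, ← Real.exp_zero]
      congr 1
      ring
    linear_combination (Wq y * Wt (u - y)) * e3
  have hex' : ∀ᵐ z : ℝ, z ∈ Ioi (0:ℝ) →
      IntegrableOn (fun y => Wt (x + z - y) * Wq y) (Ioo 0 (x + z)) := by
    have := (measurePreserving_add_left (volume : Measure ℝ) x).quasiMeasurePreserving.ae hex
    filter_upwards [this] with z hz hz0
    have hz0 : 0 < z := hz0
    exact hz (by linarith)
  -- truncated function
  have hf : IntegrableOn ((Iic x).indicator (fun y => Real.exp (-θ * y) * Wq y)) (Ioi 0) := by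
    rw [integrableOn_indicator_iff measurableSet_Iic]
    have h1 : IntegrableOn (fun y => Real.exp (-l * y) * Wq y) (Icc 0 x) := by
      rw [integrableOn_Icc_iff_integrableOn_Ioc]
      exact hq.mono_set Ioc_subset_Ioi_self
    have h2 : IntegrableOn (fun y => Real.exp ((l - θ) * y) * (Real.exp (-l * y) * Wq y))
        (Icc 0 x) := by
      refine h1.continuousOn_mul (Continuous.continuousOn (by fun_prop)) isCompact_Icc
    refine IntegrableOn.mono_set (t := Icc 0 x) ?_ (fun y hy => ?_)
    · refine h2.congr_fun (fun y _ => ?_) measurableSet_Icc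
      simp only
      rw [← mul_assoc, ← Real.exp_add]
      congr 2
      ring
    · rcases hy with ⟨h, h'⟩
      simp only [mem_Iic, mem_Ioi, mem_Icc] at *
      constructor <;> linarith
  have hK := aux_shift _ x hx
    (integrable_posConvolution hf ht (ContinuousLinearMap.mul ℝ ℝ)).integrableOn
  have hUs := aux_shift _ x hx hU
  have hfin := (hUs.const_mul (Real.exp (θ * x))).sub (hK.const_mul (c * Real.exp (θ * x)))
  refine hfin.congr ?_
  refine (ae_restrict_iff' measurableSet_Ioi).2 ?_
  filter_upwards [hex'] with z hz hz0
  have hI := hz hz0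
  have hz0 : 0 < z := hz0
  have hxz : x + z ∈ Ioi (0:ℝ) := by simp only [mem_Ioi]; linarith
  have hxz' : 0 < x + z := hxz
  have hii : IntervalIntegrable (fun y => Wt (x + z - y) * Wq y) volume 0 (x + z) := by
    rw [intervalIntegrable_iff_integrableOn_Ioo_of_le hxz'.le]
    exact hI
  have hi1 : IntervalIntegrable (fun y => Wt (x + z - y) * Wq y) volume 0 x :=
    hii.mono_set (by rw [uIcc_of_le hx, uIcc_of_le hxz'.le]; exact Icc_subset_Icc_right (by linarith))
  have hi2 : IntervalIntegrable (fun y => Wt (x + z - y) * Wq y) volume x (x + z) :=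
    hii.mono_set (by
      rw [uIcc_of_le (by linarith : x ≤ x + z), uIcc_of_le hxz'.le]
      exact Icc_subset_Icc_left hx)
  have hadd := intervalIntegral.integral_add_adjacent_intervals hi1 hi2
  have hpc : posConvolution ((Iic x).indicator (fun y => Real.exp (-θ * y) * Wq y))
      (fun y => Real.exp (-θ * y) * Wt y) (ContinuousLinearMap.mul ℝ ℝ) volume (x + z)
      = Real.exp (-θ * (x + z)) * ∫ y in (0:ℝ)..x, Wt (x + z - y) * Wq y := by
    rw [posConvolution, indicator_of_mem hxz, intervalIntegral.integral_of_le hxz'.le,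
      intervalIntegral.integral_of_le hx, ← integral_const_mul]
    have hs : Ioc (0:ℝ) x = Ioc 0 (x + z) ∩ Iic x := by
      ext y
      simp only [mem_Ioc, mem_inter_iff, mem_Iic]
      constructor
      · rintro ⟨h1, h2⟩
        exact ⟨⟨h1, by linarith⟩, h2⟩
      · rintro ⟨⟨h1, _⟩, h2⟩
        exact ⟨h1, h2⟩
    rw [hs, ← setIntegral_indicator measurableSet_Iic]
    congr 1
    funext y
    by_cases hy : y ∈ Iic x
    · simp only [indicator_of_mem hy, ContinuousLinearMap.mul_apply']
      have e3 : Real.exp (-θ * y) * Real.exp (-θ * (x + z - y)) = Real.exp (-θ * (x + z)) := by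
        rw [← Real.exp_add]
        congr 1
        ring
      rw [← e3]
      ring
    · simp only [indicator_of_notMem hy, map_zero, zero_apply]
  simp only [Pi.sub_apply]
  rw [hpc, ← hadd]
  have e4 : Real.exp (-θ * z) = Real.exp (θ * x) * Real.exp (-θ * (x + z)) := by
    rw [← Real.exp_add]
    congr 1
    ring
  rw [e4]
  ring

lemma aux_zero (v S T : ℝ → ℝ) (θ c x : ℝ)
    (hv : IntegrableOn (fun y => Real.exp (-θ * y) * v y) (Ioi 0))
    (hS : IntegrableOn (fun z => Real.exp (-θ * z) * S (x + z)) (Ioi 0))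
    (hS0 : ∫ z in Ioi (0:ℝ), Real.exp (-θ * z) * S (x + z) = 0)
    (h : ∀ u, x < u → c * (∫ y in x..u, v (u - y) * S y) = T u - S u) :
    ∫ z in Ioi (0:ℝ), Real.exp (-θ * z) * T (x + z) = 0 := by
  have hpt : ∀ z ∈ Ioi (0:ℝ), Real.exp (-θ * z) * T (x + z)
      = Real.exp (-θ * z) * S (x + z)
        + c * (posConvolution (fun z => Real.exp (-θ * z) * S (x + z))
          (fun y => Real.exp (-θ * y) * v y) (ContinuousLinearMap.mul ℝ ℝ) volume z) := by
    intro z hz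
    have hz' : 0 < z := hz
    have h1 := h (x + z) (by linarith)
    have h2 := intervalIntegral.integral_comp_add_left
      (fun y => v (x + z - y) * S y) x (a := 0) (b := z)
    rw [add_zero] at h2
    rw [← h2] at h1
    rw [posConvolution, indicator_of_mem hz]
    have h3 : (∫ t in (0:ℝ)..z, ContinuousLinearMap.mul ℝ ℝ (Real.exp (-θ * t) * S (x + t))
        (Real.exp (-θ * (z - t)) * v (z - t)))
        = Real.exp (-θ * z) * ∫ t in (0:ℝ)..z, v (x + z - (x + t)) * S (x + t) := by
      rw [← intervalIntegral.integral_const_mul]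
      congr 1
      funext t
      have e3 : Real.exp (-θ * t) * Real.exp (-θ * (z - t)) = Real.exp (-θ * z) := by
        rw [← Real.exp_add]
        congr 1
        ring
      rw [ContinuousLinearMap.mul_apply', ← e3, add_sub_add_left_eq_sub]
      ring
    rw [h3]
    linear_combination (-Real.exp (-θ * z)) * h1
  have hP := (integrable_posConvolution hS hv (ContinuousLinearMap.mul ℝ ℝ)).integrableOn
    (s := Ioi (0:ℝ))
  rw [setIntegral_congr_fun measurableSet_Ioi hpt, integral_add hS (hP.const_mul c), hS0,
    integral_const_mul]
  have h5 := integral_posConvolution hS hv (ContinuousLinearMap.mul ℝ ℝ)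
  have h6 : ∫ z in Ioi (0:ℝ), (posConvolution (fun z => Real.exp (-θ * z) * S (x + z))
          (fun y => Real.exp (-θ * y) * v y) (ContinuousLinearMap.mul ℝ ℝ) volume z) = 0 := by
    rw [hS0] at h5
    simp only [map_zero, zero_apply] at h5
    refine Eq.trans ?_ h5
    refine setIntegral_congr_fun measurableSet_Ioi fun z hz => ?_
    simp only [posConvolution, indicator_of_mem hz]
  rw [h6]
  simp

/-- For `θ` large enough, `x ≥ 0` and `λ ≠ p`,
`Z_q(x,θ)/(ψ_{q+λ}(θ)ψ_{q+p}(θ))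
  = ∫_{-∞}^0 e^{θy}(𝒲_x^{(q,λ)}(x−y) − 𝒲_x^{(q,p)}(x−y))/(λ − p) dy`. -/
theorem Z_ratio_laplace
    (ψ Φ : ℝ → ℝ) (W : ℝ → ℝ → ℝ)
    (hW_zero : ∀ s ≥ (0:ℝ), ∀ x < (0:ℝ), W s x = 0)
    (hW_lap : ∀ s ≥ (0:ℝ), ∀ l, l > Φ s →
      ∫ y in Set.Ioi (0:ℝ), Real.exp (-l * y) * W s y = 1 / (ψ l - s))
    -- `∫_0^∞ e^{-θz} 𝒲_a^{(p,s)}(a+z) dz = Z_p(a,θ)/ψ_{p+s}(θ)`: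
    (hLap2 : ∀ a ≥ (0:ℝ), ∀ p' ≥ (0:ℝ), ∀ s ≥ (0:ℝ), ∀ θ, θ > Φ (p' + s) →
      ∫ z in Set.Ioi (0:ℝ), Real.exp (-θ * z) * secondScale W a p' s (a + z)
        = Zscale ψ W p' a θ / (ψ θ - (p' + s)))
    -- `(s−(p+q))∫_a^x W_s(x−y)𝒲_a^{(p,q)}(y)dy = 𝒲_a^{(p,s−p)}(x) − 𝒲_a^{(p,q)}(x)`:
    (hconv2 : ∀ s ≥ (0:ℝ), ∀ p' ≥ (0:ℝ), ∀ q' ≥ (0:ℝ), ∀ a x : ℝ, 0 ≤ a → a < x →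
      (s - (p' + q')) * ∫ y in a..x, W s (x - y) * secondScale W a p' q' y
        = secondScale W a p' (s - p') x - secondScale W a p' q' x)
    (lam p q : ℝ) (hlam : 0 < lam) (hp : 0 < p) (hq : 0 ≤ q) (hne : lam ≠ p)
    (x : ℝ) (hx : 0 ≤ x)
    (θ : ℝ) (hθ : θ > max (Φ (q + lam)) (Φ (q + p))) :
    Zscale ψ W q x θ / ((ψ θ - (q + lam)) * (ψ θ - (q + p)))
      = ∫ y in Set.Iio (0:ℝ),
          Real.exp (θ * y) *
            ((secondScale W x q lam (x - y) - secondScale W x q p (x - y)) / (lam - p)) := by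
  have hθ1 : θ > Φ (q + lam) := lt_of_le_of_lt (le_max_left _ _) hθ
  have hθ2 : θ > Φ (q + p) := lt_of_le_of_lt (le_max_right _ _) hθ
  obtain ⟨l, hl⟩ := aux_exists ψ Φ W hW_lap q hq
  have hv : ∀ s > (0:ℝ), θ > Φ (q + s) → ψ θ - (q + s) ≠ 0 →
      IntegrableOn (fun y => Real.exp (-θ * y) * W (q + s) y) (Ioi 0) := by
    intro s hs hΦ hA
    by_contra hni
    have h := hW_lap (q + s) (by linarith) θ hΦ
    rw [integral_undef hni] at h
    exact one_div_ne_zero hA h.symm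
  have hF : ∀ s > (0:ℝ), θ > Φ (q + s) → ψ θ - (q + s) ≠ 0 →
      IntegrableOn (fun z => Real.exp (-θ * z) * secondScale W x q s (x + z)) (Ioi 0) := by
    intro s hs hΦ hA
    refine aux_F (W q) (W (q + s)) l θ s x hx hl (hv s hs hΦ hA) ?_
    by_contra hni
    have h := hLap2 0 le_rfl q hq s hs.le θ hΦ
    have h0 : Zscale ψ W q 0 θ = 1 := by simp [Zscale]
    rw [h0] at h
    simp only [zero_add, secondScale] at h
    rw [integral_undef hni] at h
    exact one_div_ne_zero hA h.symm
  have hLF := hLap2 x hx q hq lam hlam.le θ hθ1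
  have hLG := hLap2 x hx q hq p hp.le θ hθ2
  have hd : lam - p ≠ 0 := sub_ne_zero.2 hne
  have hR : ∫ y in Set.Iio (0:ℝ),
          Real.exp (θ * y) *
            ((secondScale W x q lam (x - y) - secondScale W x q p (x - y)) / (lam - p))
      = (∫ z in Ioi (0:ℝ), (Real.exp (-θ * z) * secondScale W x q lam (x + z)
          - Real.exp (-θ * z) * secondScale W x q p (x + z))) / (lam - p) := by
    rw [← integral_Iic_eq_integral_Iio, ← integral_div]
    have := integral_comp_neg_Ioi (0:ℝ) (fun y => Real.exp (θ * y) *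
            ((secondScale W x q lam (x - y) - secondScale W x q p (x - y)) / (lam - p)))
    rw [neg_zero] at this
    rw [← this]
    congr 1
    funext z
    rw [sub_neg_eq_add, mul_neg, neg_mul]
    ring
  rw [hR]
  by_cases hA : ψ θ - (q + lam) = 0
  · have hB : ψ θ - (q + p) ≠ 0 := by
      intro hB
      apply hd
      linarith
    have hG := hF p hp hθ2 hB
    rw [hA, zero_mul, div_zero]
    by_cases hFi : IntegrableOn
        (fun z => Real.exp (-θ * z) * secondScale W x q lam (x + z)) (Ioi 0)
    · rw [hA, div_zero] at hLF
      have hz := aux_zero (W (q + p)) (secondScale W x q lam) (secondScale W x q p) θ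
        (q + p - (q + lam)) x (hv p hp hθ2 hB) hFi hLF (fun u hu => by
          have := hconv2 (q + p) (by linarith) q hq lam hlam.le x u hx hu
          rwa [add_sub_cancel_left] at this)
      rw [integral_sub hFi hG, hLF, hz]
      simp
    · rw [integral_undef, zero_div]
      intro hD
      apply hFi
      refine (hD.add hG).congr (Eventually.of_forall fun z => ?_)
      simp
  · have hFi := hF lam hlam hθ1 hA
    by_cases hB : ψ θ - (q + p) = 0
    · rw [hB, mul_zero, div_zero]
      by_cases hG : IntegrableOn
          (fun z => Real.exp (-θ * z) * secondScale W x q p (x + z)) (Ioi 0)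
      · rw [hB, div_zero] at hLG
        have hz := aux_zero (W (q + lam)) (secondScale W x q p) (secondScale W x q lam) θ
          (q + lam - (q + p)) x (hv lam hlam hθ1 hA) hG hLG (fun u hu => by
            have := hconv2 (q + lam) (by linarith) q hq p hp.le x u hx hu
            rwa [add_sub_cancel_left] at this)
        rw [integral_sub hFi hG, hLG, hz]
        simp
      · rw [integral_undef, zero_div]
        intro hD
        apply hG
        refine (hFi.sub hD).congr (Eventually.of_forall fun z => ?_)
        simp
    · have hG := hF p hp hθ2 hB
      rw [integral_sub hFi hG, hLF, hLG]
      field_simp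
      ring
end
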